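/- Let m ≥ 1 be an integer and let α, β ∈ ℂ satisfy Re α > -m, Re β > -m and Re(α+β) < -m. Then for every x ∈ ℝ^m with x ≠ 0 and every index j ∈ {1,…,m}, the function y ↦ (x_j - y_j)|x-y|^{α-1}|y|^β is integrable on ℝ^m and ∫_{ℝ^m} (x_j - y_j)|x-y|^{α-1}|y|^β dy = π^{m/2} · [Γ((α+m+1)/2) Γ((β+m)/2) Γ((1-α-β-m)/2)] / [Γ((1-α)/2) Γ(-β/2) Γ((α+β+2m+1)/2)] · x_j |x|^{α+β+m-1}. (This is the componentwise form of the convolution formula U*_α ∗ T*_β = π^{m/2} Γ(-(α+β+m-1)/2)/(Γ(-(α-1)/2)Γ(-β/2)) · U*_{α+β+m} of Proposition 2.1(ii), in the parameter region where the convolution integral converges absolutely.) -/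

import Mathlib

open MeasureTheory

theorem integrable_prod_comp_scale {f : ℝ × ℝ → ℂ} (hm : Measurable f)
    (hf : Integrable f ((volume.restrict (Set.Ioi 0)).prod (volume.restrict (Set.Ioi 0)))) :
    Integrable (fun p : ℝ × ℝ => (p.1 : ℂ) * f (p.1, p.1 * p.2))
      ((volume.restrict (Set.Ioi 0)).prod (volume.restrict (Set.Ioi 0))) := by
  obtain ⟨h1, h2⟩ := (integrable_prod_iff hf.aestronglyMeasurable).1 hf
  refine (integrable_prod_iff (by fun_prop)).2 ⟨?_, ?_⟩
  · filter_upwards [h1, ae_restrict_mem measurableSet_Ioi] with s hs hs0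
    refine Integrable.const_mul ?_ _
    have := (integrableOn_Ioi_comp_mul_left_iff (fun t => f (s, t)) 0 (a := s) hs0).2
      (by simpa [IntegrableOn] using hs)
    exact this
  · refine h2.congr ?_
    filter_upwards [ae_restrict_mem measurableSet_Ioi] with s hs0
    have hs : (0 : ℝ) < s := hs0
    have := integral_comp_mul_left_Ioi' (fun t => ‖f (s, t)‖) 0 hs
    simp only [norm_mul, Complex.norm_real, Real.norm_of_nonneg hs.le]
    rw [integral_const_mul]
    simpa using this.symm

theorem integral_prod_eq_integral_scale {f : ℝ × ℝ → ℂ} (hm : Measurable f)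
    (hf : Integrable f ((volume.restrict (Set.Ioi 0)).prod (volume.restrict (Set.Ioi 0)))) :
    ∫ p, f p ∂((volume.restrict (Set.Ioi 0)).prod (volume.restrict (Set.Ioi 0))) =
      ∫ v in Set.Ioi (0 : ℝ), ∫ s in Set.Ioi (0 : ℝ), (s : ℂ) * f (s, s * v) := by
  rw [← integral_prod_symm _ (integrable_prod_comp_scale hm hf),
    integral_prod _ (integrable_prod_comp_scale hm hf), integral_prod _ hf]
  refine setIntegral_congr_fun measurableSet_Ioi fun s hs => ?_
  have hs : (0 : ℝ) < s := hs
  have := integral_comp_mul_left_Ioi' (fun t => f (s, t)) 0 hs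
  simp only [integral_const_mul]
  simpa using this.symm

theorem ofReal_cpow_eq_exp {r : ℝ} (hr : 0 < r) (z : ℂ) :
    (r : ℂ) ^ z = Complex.exp (Real.log r * z) := by
  rw [Complex.cpow_def_of_ne_zero (by exact_mod_cast hr.ne'), Complex.ofReal_log hr.le]

theorem ofReal_eq_exp_log {r : ℝ} (hr : 0 < r) :
    (r : ℂ) = Complex.exp (Real.log r) := by
  rw [← Complex.ofReal_exp, Real.exp_log hr]

theorem integrable_cpow_mul_exp_neg_mul_Ioi {a : ℂ} (ha : 0 < a.re) {r : ℝ} (hr : 0 < r) :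
    Integrable (fun t : ℝ => (t : ℂ) ^ (a - 1) * Complex.exp (-(r * t)))
      (volume.restrict (Set.Ioi 0)) := by
  have h : Integrable (fun t : ℝ => t ^ (a.re - 1) * Real.exp (-(r * t)))
      (volume.restrict (Set.Ioi 0)) := by
    refine Integrable.of_integral_ne_zero ?_
    rw [Real.integral_rpow_mul_exp_neg_mul_Ioi ha hr]
    have := Real.Gamma_pos_of_pos ha
    positivity
  refine h.mono' (by fun_prop) ?_
  filter_upwards [ae_restrict_mem measurableSet_Ioi] with t ht
  have ht : (0 : ℝ) < t := ht
  rw [norm_mul, Complex.norm_cpow_eq_rpow_re_of_pos ht, Complex.norm_exp]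
  simp

theorem integral_norm_cpow_mul_exp_neg_mul_Ioi {a : ℂ} (ha : 0 < a.re) {r : ℝ} (hr : 0 < r) :
    ∫ t in Set.Ioi (0 : ℝ), ‖(t : ℂ) ^ (a - 1) * Complex.exp (-(r * t))‖ =
      (1 / r) ^ a.re * Real.Gamma a.re := by
  rw [← Real.integral_rpow_mul_exp_neg_mul_Ioi ha hr]
  refine setIntegral_congr_fun measurableSet_Ioi fun t ht => ?_
  have ht : (0 : ℝ) < t := ht
  rw [norm_mul, Complex.norm_cpow_eq_rpow_re_of_pos ht, Complex.norm_exp]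
  simp

theorem integral_Ioi_cpow_mul_one_add_cpow {p q : ℂ} (hp : 0 < p.re) (hq : 0 < q.re) :
    ∫ v in Set.Ioi (0 : ℝ), (v : ℂ) ^ (q - 1) * ((1 + v : ℝ) : ℂ) ^ (-(p + q)) =
      Complex.Gamma p * Complex.Gamma q / Complex.Gamma (p + q) := by
  have hpq : 0 < (p + q).re := by simp; linarith
  rw [eq_div_iff (Complex.Gamma_ne_zero_of_re_pos hpq)]
  have e := integral_prod_eq_integral_scale
    (f := fun z => ((z.1 : ℂ) ^ (p - 1) * Complex.exp (-((1 : ℝ) * z.1))) *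
      ((z.2 : ℂ) ^ (q - 1) * Complex.exp (-((1 : ℝ) * z.2)))) (by fun_prop)
    ((integrable_cpow_mul_exp_neg_mul_Ioi hp one_pos).mul_prod
      (integrable_cpow_mul_exp_neg_mul_Ioi hq one_pos))
  rw [integral_prod_mul (fun s : ℝ => (s : ℂ) ^ (p - 1) * Complex.exp (-((1 : ℝ) * s)))
      (fun s : ℝ => (s : ℂ) ^ (q - 1) * Complex.exp (-((1 : ℝ) * s))),
    Complex.integral_cpow_mul_exp_neg_mul_Ioi hp (by simp),
    Complex.integral_cpow_mul_exp_neg_mul_Ioi hq (by simp)] at e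
  simp only [Complex.ofReal_one, div_one, Complex.one_cpow, one_mul] at e
  rw [e, ← integral_mul_const]
  refine setIntegral_congr_fun measurableSet_Ioi fun v hv => ?_
  have hv : (0 : ℝ) < v := hv
  have hv1 : (0 : ℝ) < 1 + v := by linarith
  have := Complex.integral_cpow_mul_exp_neg_mul_Ioi hpq hv1
  rw [show ((1 + v : ℝ) : ℂ) ^ (-(p + q)) = (1 / ((1 + v : ℝ) : ℂ)) ^ (p + q) by
    rw [← Complex.ofReal_one, ← Complex.ofReal_div, ofReal_cpow_eq_exp (by positivity),
      ofReal_cpow_eq_exp (by positivity), Real.log_div one_ne_zero hv1.ne']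
    congr 1
    push_cast
    simp
    ring, mul_assoc, ← this, ← integral_const_mul]
  refine setIntegral_congr_fun measurableSet_Ioi fun s hs => ?_
  have hs : (0 : ℝ) < s := hs
  rw [ofReal_cpow_eq_exp hv, ofReal_cpow_eq_exp hs, ofReal_cpow_eq_exp hs,
    ofReal_cpow_eq_exp (mul_pos hs hv), Real.log_mul hs.ne' hv.ne']
  nth_rw 2 [ofReal_eq_exp_log hs]
  simp only [← Complex.exp_add]
  congr 1
  push_cast
  ring

theorem integrable_coord_mul_exp {m : ℕ} (hm : 1 ≤ m) (j : Fin m) {k : ℝ} (hk : 0 < k) :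
    Integrable (fun z : EuclideanSpace ℝ (Fin m) => z j * Real.exp (-k * ‖z‖ ^ 2)) := by
  have : Nonempty (Fin m) := ⟨j⟩
  have h : Integrable (fun z : EuclideanSpace ℝ (Fin m) => ‖z‖ * Real.exp (-k * ‖z‖ ^ 2)) := by
    refine (integrable_fun_norm_addHaar volume (f := fun t => t * Real.exp (-k * t ^ 2))).2 ?_
    refine (integrableOn_rpow_mul_exp_neg_mul_sq hk (s := m)
      (by have : (0 : ℝ) ≤ m := by positivity
          linarith)).congr_fun (fun t ht => ?_) measurableSet_Ioi
    simp only [finrank_euclideanSpace, Fintype.card_fin, smul_eq_mul, Real.rpow_natCast]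
    obtain ⟨n, rfl⟩ : ∃ n, m = n + 1 := ⟨m - 1, by omega⟩
    simp only [Nat.add_sub_cancel]
    ring
  refine h.mono' (by fun_prop) (Filter.Eventually.of_forall fun z => ?_)
  rw [norm_mul, Real.norm_of_nonneg (Real.exp_pos _).le]
  gcongr
  exact PiLp.norm_apply_le z j

theorem integrable_exp_neg_mul_norm_sq {m : ℕ} {k : ℝ} (hk : 0 < k) :
    Integrable (fun z : EuclideanSpace ℝ (Fin m) => Real.exp (-k * ‖z‖ ^ 2)) := by
  refine Integrable.of_integral_ne_zero ?_
  rw [GaussianFourier.integral_rexp_neg_mul_sq_norm hk]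
  positivity

theorem integral_coord_sub_mul_exp {m : ℕ} (hm : 1 ≤ m) (x : EuclideanSpace ℝ (Fin m))
    (j : Fin m) {s t : ℝ} (hs : 0 < s) (ht : 0 < t) :
    ∫ y : EuclideanSpace ℝ (Fin m),
      (x j - y j) * (Real.exp (-(‖x - y‖ ^ 2 * s)) * Real.exp (-(‖y‖ ^ 2 * t))) =
      t / (s + t) * x j * (Real.pi / (s + t)) ^ ((m : ℝ) / 2) *
        Real.exp (-(s * t / (s + t) * ‖x‖ ^ 2)) := by
  have hk : 0 < s + t := by positivity
  rw [← integral_add_right_eq_self _ ((s / (s + t)) • x)]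
  have key : ∀ z : EuclideanSpace ℝ (Fin m),
      (x j - (z + (s / (s + t)) • x) j) * (Real.exp (-(‖x - (z + (s / (s + t)) • x)‖ ^ 2 * s)) *
        Real.exp (-(‖z + (s / (s + t)) • x‖ ^ 2 * t))) =
      Real.exp (-(s * t / (s + t) * ‖x‖ ^ 2)) *
        (t / (s + t) * x j * Real.exp (-(s + t) * ‖z‖ ^ 2) -
          z j * Real.exp (-(s + t) * ‖z‖ ^ 2)) := by
    intro z
    have h1 : x - (z + (s / (s + t)) • x) = (t / (s + t)) • x - z := by
      have : t / (s + t) = 1 - s / (s + t) := by field_simp; ring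
      rw [this, sub_smul, one_smul]; abel
    have h2 : x j - (z + (s / (s + t)) • x) j = t / (s + t) * x j - z j := by
      simp; field_simp; ring
    rw [h2, h1, ← Real.exp_add, ← sub_mul, mul_left_comm, ← Real.exp_add]
    congr 2
    rw [@norm_sub_sq_real, @norm_add_sq_real, norm_smul, norm_smul, inner_smul_left,
      inner_smul_right, real_inner_comm, mul_pow, mul_pow, Real.norm_eq_abs, Real.norm_eq_abs,
      sq_abs, sq_abs]
    simp only [conj_trivial]
    field_simp
    ring
  simp only [key]
  rw [integral_const_mul, integral_sub ((integrable_exp_neg_mul_norm_sq hk).const_mul _)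
    (integrable_coord_mul_exp hm j hk), integral_const_mul,
    GaussianFourier.integral_rexp_neg_mul_sq_norm hk]
  have odd : ∫ z : EuclideanSpace ℝ (Fin m), z j * Real.exp (-(s + t) * ‖z‖ ^ 2) = 0 := by
    have := integral_neg_eq_self
      (fun z : EuclideanSpace ℝ (Fin m) => z j * Real.exp (-(s + t) * ‖z‖ ^ 2)) volume
    simp only [norm_neg, PiLp.neg_apply, neg_mul, integral_neg] at this ⊢
    linarith
  rw [odd, finrank_euclideanSpace_fin]
  ring

theorem integrable_max_norm_rpow_mul_norm_rpow {m : ℕ} (hm : 1 ≤ m) {A B r : ℝ} (hr : 0 < r)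
    (hB : -(m : ℝ) < B) (hAB : A + B < -(m : ℝ)) :
    Integrable (fun y : EuclideanSpace ℝ (Fin m) => (max ‖y‖ r) ^ A * ‖y‖ ^ B) := by
  have : Nonempty (Fin m) := ⟨⟨0, hm⟩⟩
  refine (integrable_fun_norm_addHaar volume (f := fun t => (max t r) ^ A * t ^ B)).2 ?_
  simp only [finrank_euclideanSpace, Fintype.card_fin, smul_eq_mul]
  have hpow : ∀ t : ℝ, 0 < t → t ^ (m - 1) = t ^ ((m : ℝ) - 1) := fun t ht => by
    rw [← Real.rpow_natCast, Nat.cast_sub hm, Nat.cast_one]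
  rw [← Set.Ioc_union_Ioi_eq_Ioi hr.le]
  refine IntegrableOn.union ?_ ?_
  · have h : IntegrableOn (fun t : ℝ => t ^ ((m : ℝ) - 1 + B)) (Set.Ioc 0 r) := by
      rw [← intervalIntegrable_iff_integrableOn_Ioc_of_le hr.le]
      exact intervalIntegral.intervalIntegrable_rpow' (by linarith)
    refine IntegrableOn.congr_fun (h.const_mul (r ^ A)) (fun t ht => ?_) measurableSet_Ioc
    rw [hpow t ht.1, max_eq_right ht.2, Real.rpow_add ht.1]
    ring
  · have h : IntegrableOn (fun t : ℝ => t ^ ((m : ℝ) - 1 + (A + B))) (Set.Ioi r) :=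
      integrableOn_Ioi_rpow_of_lt (by linarith) hr
    refine h.congr_fun (fun t ht => ?_) measurableSet_Ioi
    have ht' : r < t := ht
    have ht0 : 0 < t := hr.trans ht'
    simp only
    rw [hpow t ht0, max_eq_left ht'.le, Real.rpow_add ht0, Real.rpow_add ht0]

theorem integrable_norm_sub_rpow_mul_norm_rpow {m : ℕ} (hm : 1 ≤ m) {A B : ℝ}
    (hA : -(m : ℝ) < A) (hB : -(m : ℝ) < B) (hAB : A + B < -(m : ℝ))
    {x : EuclideanSpace ℝ (Fin m)} (hx : x ≠ 0) :
    Integrable (fun y : EuclideanSpace ℝ (Fin m) => ‖x - y‖ ^ A * ‖y‖ ^ B) := by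
  have hr : 0 < ‖x‖ / 2 := by positivity
  have h1 := integrable_max_norm_rpow_mul_norm_rpow hm hr hB hAB
  have h2 := (integrable_max_norm_rpow_mul_norm_rpow hm hr hA
    (by rwa [add_comm])).comp_sub_left x
  refine (h1.add h2).mono' (by fun_prop) (Filter.Eventually.of_forall fun y => ?_)
  have tri : ‖x‖ ≤ ‖x - y‖ + ‖y‖ := by simpa using norm_add_le (x - y) y
  rw [Real.norm_of_nonneg (by positivity)]
  simp only [Pi.add_apply]
  have n1 : 0 ≤ (max ‖y‖ (‖x‖ / 2)) ^ A * ‖y‖ ^ B := by positivity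
  have n2 : 0 ≤ (max ‖x - y‖ (‖x‖ / 2)) ^ B * ‖x - y‖ ^ A := by positivity
  rcases le_total ‖y‖ ‖x - y‖ with h | h
  · have : ‖x - y‖ ^ A ≤ (max ‖y‖ (‖x‖ / 2)) ^ A :=
      Real.rpow_le_rpow_of_nonpos (lt_max_of_lt_right hr) (max_le h (by linarith)) (by linarith)
    have := mul_le_mul_of_nonneg_right this (by positivity : 0 ≤ ‖y‖ ^ B)
    linarith
  · have : ‖y‖ ^ B ≤ (max ‖x - y‖ (‖x‖ / 2)) ^ B :=
      Real.rpow_le_rpow_of_nonpos (lt_max_of_lt_right hr) (max_le h (by linarith)) (by linarith)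
    have := mul_le_mul_of_nonneg_right this (by positivity : 0 ≤ ‖x - y‖ ^ A)
    linarith

theorem one_div_sq_cpow {r : ℝ} (hr : 0 < r) (a : ℂ) :
    (1 / ((r ^ 2 : ℝ) : ℂ)) ^ a = (r : ℂ) ^ (-2 * a) := by
  rw [← Complex.ofReal_one, ← Complex.ofReal_div, ofReal_cpow_eq_exp (by positivity),
    ofReal_cpow_eq_exp hr, one_div, Real.log_inv, Real.log_pow]
  congr 1
  push_cast
  ring

theorem one_div_sq_rpow {r : ℝ} (hr : 0 < r) (a : ℝ) : (1 / r ^ 2) ^ a = r ^ (-2 * a) := by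
  rw [one_div, ← Real.rpow_natCast, ← Real.rpow_neg hr.le, ← Real.rpow_mul hr.le]
  norm_num

theorem integral_Ioi_scaled_gaussian {m : ℕ} {a b : ℂ} {ρ ξ v : ℝ} (hρ : 0 < ρ) (hv : 0 < v)
    (hc : 0 < (a + b - m / 2).re) :
    ∫ s in Set.Ioi (0 : ℝ), (s : ℂ) * ((s : ℂ) ^ (a - 1) * ((s * v : ℝ) : ℂ) ^ (b - 1) *
      (((s * v) / (s + s * v) * ξ * (Real.pi / (s + s * v)) ^ ((m : ℝ) / 2) *
        Real.exp (-(s * (s * v) / (s + s * v) * ρ ^ 2)) : ℝ) : ℂ)) =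
      (Real.pi : ℂ) ^ ((m : ℂ) / 2) * ξ * Complex.Gamma (a + b - m / 2) *
        (ρ : ℂ) ^ (-2 * (a + b - m / 2)) *
        ((v : ℂ) ^ ((m / 2 - a + 1) - 1) *
          ((1 + v : ℝ) : ℂ) ^ (-((m / 2 - b) + (m / 2 - a + 1)))) := by
  have hv1 : 0 < 1 + v := by positivity
  have hr : 0 < ρ ^ 2 * v / (1 + v) := by positivity
  have key := Complex.integral_cpow_mul_exp_neg_mul_Ioi hc hr
  have e : (1 / ((ρ ^ 2 * v / (1 + v) : ℝ) : ℂ)) ^ (a + b - m / 2) =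
      Complex.exp ((-2 * Real.log ρ - Real.log v + Real.log (1 + v)) * (a + b - m / 2)) := by
    rw [← Complex.ofReal_one, ← Complex.ofReal_div, ofReal_cpow_eq_exp (by positivity), one_div,
      Real.log_inv, Real.log_div (by positivity) hv1.ne', Real.log_mul (by positivity) hv.ne',
      Real.log_pow]
    congr 1
    push_cast
    ring
  have e2 : (Real.pi : ℂ) ^ ((m : ℂ) / 2) * ξ * Complex.Gamma (a + b - m / 2) *
        (ρ : ℂ) ^ (-2 * (a + b - m / 2)) *
        ((v : ℂ) ^ ((m / 2 - a + 1) - 1) *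
          ((1 + v : ℝ) : ℂ) ^ (-((m / 2 - b) + (m / 2 - a + 1)))) =
      ((Real.pi : ℂ) ^ ((m : ℂ) / 2) * ξ * (v : ℂ) ^ b * ((1 + v : ℝ) : ℂ) ^ (-(m / 2 + 1) : ℂ)) *
        ((1 / ((ρ ^ 2 * v / (1 + v) : ℝ) : ℂ)) ^ (a + b - m / 2) *
          Complex.Gamma (a + b - m / 2)) := by
    rw [e, ofReal_cpow_eq_exp hρ, ofReal_cpow_eq_exp hv, ofReal_cpow_eq_exp hv,
      ofReal_cpow_eq_exp hv1, ofReal_cpow_eq_exp hv1]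
    have : Complex.exp (Real.log ρ * (-2 * (a + b - m / 2))) *
        (Complex.exp (Real.log v * ((m / 2 - a + 1) - 1)) *
        Complex.exp (Real.log (1 + v) * (-((m / 2 - b) + (m / 2 - a + 1))))) =
        Complex.exp (Real.log v * b) * Complex.exp (Real.log (1 + v) * (-(m / 2 + 1))) *
        Complex.exp ((-2 * Real.log ρ - Real.log v + Real.log (1 + v)) * (a + b - m / 2)) := by
      simp only [← Complex.exp_add]
      congr 1
      ring
    linear_combination ((Real.pi : ℂ) ^ ((m : ℂ) / 2) * ξ * Complex.Gamma (a + b - m / 2)) * this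
  rw [e2, ← key, ← integral_const_mul]
  refine setIntegral_congr_fun measurableSet_Ioi fun s hs => ?_
  have hs : (0 : ℝ) < s := hs
  have hsv : s + s * v = s * (1 + v) := by ring
  have r1 : s * v / (s * (1 + v)) = v / (1 + v) := by field_simp
  have r2 : s * (s * v) / (s * (1 + v)) * ρ ^ 2 = ρ ^ 2 * v / (1 + v) * s := by field_simp
  rw [hsv, r1, r2]
  push_cast [Complex.ofReal_cpow (show 0 ≤ Real.pi / (s * (1 + v)) by positivity)]
  have p1 : ((Real.pi : ℂ) / (s * (1 + v))) ^ ((m : ℂ) / 2) = Complex.exp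
      ((Real.log Real.pi - Real.log s - Real.log (1 + v)) * (m / 2)) := by
    have := ofReal_cpow_eq_exp (show 0 < Real.pi / (s * (1 + v)) by positivity) (m / 2)
    rw [Real.log_div Real.pi_ne_zero (by positivity), Real.log_mul hs.ne' hv1.ne'] at this
    push_cast at this
    rw [this]
    congr 1
    ring
  have p2 : ((s : ℂ) * v) ^ (b - 1) = Complex.exp ((Real.log s + Real.log v) * (b - 1)) := by
    have := ofReal_cpow_eq_exp (mul_pos hs hv) (b - 1)
    rw [Real.log_mul hs.ne' hv.ne'] at this
    push_cast at this
    exact this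
  have p3 : (1 + (v : ℂ)) = Complex.exp (Real.log (1 + v)) := by
    rw [← ofReal_eq_exp_log hv1]; push_cast; rfl
  have p4 : ((1 + (v : ℂ)) ^ (-(m / 2 + 1) : ℂ)) =
      Complex.exp (Real.log (1 + v) * (-(m / 2 + 1))) := by
    rw [← ofReal_cpow_eq_exp hv1]; push_cast; rfl
  have p5 : (v : ℂ) / (1 + v) = Complex.exp (Real.log v - Real.log (1 + v)) := by
    rw [Complex.exp_sub, ← p3, ← ofReal_eq_exp_log hv]
  rw [p1, p2, p4, p5, ofReal_cpow_eq_exp hs, ofReal_cpow_eq_exp hs,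
    ofReal_cpow_eq_exp Real.pi_pos, ofReal_cpow_eq_exp hv]
  have : Complex.exp (Real.log s) * Complex.exp (Real.log s * (a - 1)) *
      Complex.exp ((Real.log s + Real.log v) * (b - 1)) *
      Complex.exp (Real.log v - Real.log (1 + v)) *
      Complex.exp ((Real.log Real.pi - Real.log s - Real.log (1 + v)) * (m / 2)) =
      Complex.exp (Real.log Real.pi * (m / 2)) * Complex.exp (Real.log v * b) *
      Complex.exp (Real.log (1 + v) * (-(m / 2 + 1))) *
      Complex.exp (Real.log s * (a + b - m / 2 - 1)) := by
    simp only [← Complex.exp_add]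
    congr 1
    ring
  rw [← ofReal_eq_exp_log hs] at this
  linear_combination (ξ * Complex.exp (-(ρ ^ 2 * v / (1 + v) * s))) * this

theorem convolution_Ustar_Tstar
    (m : ℕ) (hm : 1 ≤ m) (α β : ℂ)
    (hα : -(m : ℝ) < α.re) (hβ : -(m : ℝ) < β.re) (hαβ : (α + β).re < -(m : ℝ))
    (x : EuclideanSpace ℝ (Fin m)) (hx : x ≠ 0) (j : Fin m) :
    Integrable (fun y : EuclideanSpace ℝ (Fin m) =>
      ((x j - y j : ℝ) : ℂ) * ((‖x - y‖ : ℂ) ^ (α - 1)) * ((‖y‖ : ℂ) ^ β)) ∧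
    ∫ y : EuclideanSpace ℝ (Fin m),
        ((x j - y j : ℝ) : ℂ) * ((‖x - y‖ : ℂ) ^ (α - 1)) * ((‖y‖ : ℂ) ^ β) =
      (Real.pi : ℂ) ^ ((m : ℂ) / 2) *
        (Complex.Gamma ((α + m + 1) / 2) * Complex.Gamma ((β + m) / 2) *
          Complex.Gamma ((1 - α - β - m) / 2) /
        (Complex.Gamma ((1 - α) / 2) * Complex.Gamma (-β / 2) *
          Complex.Gamma ((α + β + 2 * m + 1) / 2))) *
      ((x j : ℝ) : ℂ) * (‖x‖ : ℂ) ^ (α + β + m - 1) := by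
  have : Nonempty (Fin m) := ⟨j⟩
  rw [Complex.add_re] at hαβ
  have hρ : 0 < ‖x‖ := by positivity
  have ae : ∀ᵐ y : EuclideanSpace ℝ (Fin m), 0 < ‖x - y‖ ∧ 0 < ‖y‖ := by
    filter_upwards [(Set.countable_singleton x).ae_notMem volume,
      (Set.countable_singleton (0 : EuclideanSpace ℝ (Fin m))).ae_notMem volume] with y h1 h2
    exact ⟨norm_pos_iff.2 (sub_ne_zero.2 fun h => h1 h.symm), norm_pos_iff.2 h2⟩
  have hI : Integrable (fun y : EuclideanSpace ℝ (Fin m) =>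
      ((x j - y j : ℝ) : ℂ) * ((‖x - y‖ : ℂ) ^ (α - 1)) * ((‖y‖ : ℂ) ^ β)) := by
    refine (integrable_norm_sub_rpow_mul_norm_rpow hm hα hβ hαβ hx).mono' ?_ ?_
    · exact Measurable.aestronglyMeasurable (by fun_prop)
    · filter_upwards [ae] with y hy
      rw [norm_mul, norm_mul, Complex.norm_cpow_eq_rpow_re_of_pos hy.1,
        Complex.norm_cpow_eq_rpow_re_of_pos hy.2, Complex.norm_real, Complex.sub_re,
        Complex.one_re, Real.rpow_sub_one hy.1.ne']
      have h : ‖x j - y j‖ ≤ ‖x - y‖ := PiLp.norm_apply_le (x - y) j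
      gcongr
      rw [← mul_div_assoc, div_le_iff₀ hy.1, mul_comm]
      gcongr
  refine ⟨hI, ?_⟩
  set a : ℂ := (1 - α) / 2 with ha_def
  set b : ℂ := -β / 2 with hb_def
  have two (z : ℂ) : (z / 2).re = z.re / 2 := by
    simp
  have ha : 0 < a.re := by rw [ha_def, two]; simp; linarith
  have hb : 0 < b.re := by rw [hb_def, two]; simp; linarith
  have hmre : ((m : ℂ) / 2).re = (m : ℝ) / 2 := by rw [two]; simp
  have hare : a.re = (1 - α.re) / 2 := by rw [ha_def, two]; simp
  have hbre : b.re = -β.re / 2 := by rw [hb_def, two]; simp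
  have hc : 0 < (a + b - m / 2).re := by
    simp only [Complex.sub_re, Complex.add_re, hmre, hare, hbre]; linarith
  have hp : 0 < ((m : ℂ) / 2 - b).re := by
    simp only [Complex.sub_re, hmre, hbre]; linarith
  have hq : 0 < ((m : ℂ) / 2 - a + 1).re := by
    simp only [Complex.sub_re, Complex.add_re, Complex.one_re, hmre, hare]; linarith
  have hα' : α - 1 = -2 * a := by rw [ha_def]; ring
  have hβ' : β = -2 * b := by rw [hb_def]; ring
  set ν : Measure (ℝ × ℝ) :=
    (volume.restrict (Set.Ioi 0)).prod (volume.restrict (Set.Ioi 0)) with hν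
  set F : EuclideanSpace ℝ (Fin m) × (ℝ × ℝ) → ℂ := fun w =>
    ((x j - w.1 j : ℝ) : ℂ) *
      (((w.2.1 : ℂ) ^ (a - 1) * Complex.exp (-(((‖x - w.1‖ ^ 2 : ℝ) : ℂ) * w.2.1))) *
        ((w.2.2 : ℂ) ^ (b - 1) * Complex.exp (-(((‖w.1‖ ^ 2 : ℝ) : ℂ) * w.2.2)))) with hF
  have hFm : Measurable F := by fun_prop
  have hFint : Integrable F (volume.prod ν) := by
    refine (integrable_prod_iff hFm.aestronglyMeasurable).2 ⟨?_, ?_⟩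
    · filter_upwards [ae] with y hy
      exact ((integrable_cpow_mul_exp_neg_mul_Ioi ha (pow_pos hy.1 2)).mul_prod
        (integrable_cpow_mul_exp_neg_mul_Ioi hb (pow_pos hy.2 2))).const_mul
          ((x j - y j : ℝ) : ℂ)
    · refine (hI.norm.mul_const (Real.Gamma a.re * Real.Gamma b.re)).congr ?_
      filter_upwards [ae] with y hy
      simp only [hF, norm_mul (α := ℂ) (Complex.ofReal _)]
      simp only [norm_mul ((_ : ℂ) ^ (a - 1) * _)]
      rw [integral_const_mul, integral_prod_mul
        (fun s : ℝ => ‖(s : ℂ) ^ (a - 1) * Complex.exp (-(((‖x - y‖ ^ 2 : ℝ) : ℂ) * s))‖)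
        (fun s : ℝ => ‖(s : ℂ) ^ (b - 1) * Complex.exp (-(((‖y‖ ^ 2 : ℝ) : ℂ) * s))‖),
        integral_norm_cpow_mul_exp_neg_mul_Ioi ha (pow_pos hy.1 2),
        integral_norm_cpow_mul_exp_neg_mul_Ioi hb (pow_pos hy.2 2), one_div_sq_rpow hy.1,
        one_div_sq_rpow hy.2, norm_mul, norm_mul, Complex.norm_cpow_eq_rpow_re_of_pos hy.1,
        Complex.norm_cpow_eq_rpow_re_of_pos hy.2, hα']
      have e1 : (-2 * a).re = -2 * a.re := by simp
      have e2 : β.re = -2 * b.re := by rw [hbre]; ring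
      rw [e1, e2]
      ring
  have lhs : ∫ w, F w ∂(volume.prod ν) = (∫ y : EuclideanSpace ℝ (Fin m),
      ((x j - y j : ℝ) : ℂ) * ((‖x - y‖ : ℂ) ^ (α - 1)) * ((‖y‖ : ℂ) ^ β)) *
      (Complex.Gamma a * Complex.Gamma b) := by
    rw [integral_prod _ hFint, ← integral_mul_const]
    refine integral_congr_ae ?_
    filter_upwards [ae] with y hy
    simp only [hF]
    rw [integral_const_mul, integral_prod_mul
      (fun s : ℝ => (s : ℂ) ^ (a - 1) * Complex.exp (-(((‖x - y‖ ^ 2 : ℝ) : ℂ) * s)))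
      (fun s : ℝ => (s : ℂ) ^ (b - 1) * Complex.exp (-(((‖y‖ ^ 2 : ℝ) : ℂ) * s))),
      Complex.integral_cpow_mul_exp_neg_mul_Ioi ha (pow_pos hy.1 2),
      Complex.integral_cpow_mul_exp_neg_mul_Ioi hb (pow_pos hy.2 2), one_div_sq_cpow hy.1,
      one_div_sq_cpow hy.2, hα', ← hβ']
    ring
  set G : ℝ × ℝ → ℂ := fun p => (p.1 : ℂ) ^ (a - 1) * (p.2 : ℂ) ^ (b - 1) *
    ((p.2 / (p.1 + p.2) * x j * (Real.pi / (p.1 + p.2)) ^ ((m : ℝ) / 2) *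
      Real.exp (-(p.1 * p.2 / (p.1 + p.2) * ‖x‖ ^ 2)) : ℝ) : ℂ) with hG
  have hGm : Measurable G := by fun_prop
  have hpos : ∀ᵐ p ∂ν, 0 < p.1 ∧ 0 < p.2 := by
    rw [hν, Measure.prod_restrict]
    exact ae_restrict_mem (measurableSet_Ioi.prod measurableSet_Ioi)
  have hFG : (fun p => ∫ y, F (y, p)) =ᵐ[ν] G := by
    filter_upwards [hpos] with p hp
    have key := integral_coord_sub_mul_exp hm x j hp.1 hp.2
    simp only [hG]
    rw [← key, ← integral_complex_ofReal, ← integral_const_mul]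
    congr 1 with y
    simp only [hF]
    push_cast
    ring
  have hGint : Integrable G ν := hFint.integral_prod_right.congr hFG
  have rhs : ∫ w, F w ∂(volume.prod ν) =
      (Real.pi : ℂ) ^ ((m : ℂ) / 2) * (x j : ℂ) * Complex.Gamma (a + b - m / 2) *
        (‖x‖ : ℂ) ^ (-2 * (a + b - m / 2)) *
        (Complex.Gamma (m / 2 - b) * Complex.Gamma (m / 2 - a + 1) /
          Complex.Gamma ((m / 2 - b) + (m / 2 - a + 1))) := by
    rw [integral_prod_symm _ hFint, integral_congr_ae hFG,
      integral_prod_eq_integral_scale hGm hGint, ← integral_Ioi_cpow_mul_one_add_cpow hp hq,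
      ← integral_const_mul]
    refine setIntegral_congr_fun measurableSet_Ioi fun v hv => ?_
    exact integral_Ioi_scaled_gaussian hρ hv hc
  have ga := Complex.Gamma_ne_zero_of_re_pos ha
  have gb := Complex.Gamma_ne_zero_of_re_pos hb
  have gpq := Complex.Gamma_ne_zero_of_re_pos (s := (m : ℂ) / 2 - b + (m / 2 - a + 1))
    (by rw [Complex.add_re]; linarith)
  have c1 : (α + m + 1) / 2 = m / 2 - a + 1 := by rw [ha_def]; ring
  have c2 : (β + m) / 2 = m / 2 - b := by rw [hb_def]; ring
  have c3 : (1 - α - β - m) / 2 = a + b - m / 2 := by rw [ha_def, hb_def]; ring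
  have c4 : (α + β + 2 * m + 1) / 2 = (m / 2 - b) + (m / 2 - a + 1) := by
    rw [ha_def, hb_def]; ring
  have c5 : α + β + m - 1 = -2 * (a + b - m / 2) := by rw [ha_def, hb_def]; ring
  rw [c1, c2, c3, c4, c5, eq_div_of_mul_eq (mul_ne_zero ga gb) (lhs.symm.trans rhs)]
  field_simp
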